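/- Let A be an abelian group and z an automorphism of A ≅ Z_p^d. If q ∈ Z_p[t] is a polynomial coprime to (t−1), then z acts on K = ker q(z) ⊆ A with fixed-point set K^z finite; in particular if the semidirect product K ⋊_z Z_p is nilpotent then K is finite. -/

import Mathlib

open Polynomial

theorem Polynomial.eval_ne_zero_of_isCoprime_map_X_sub_C {R S : Type*} [CommRing R] [CommRing S]
    [Nontrivial S] (f : R →+* S) {q : R[X]} {a : R}
    (hq : IsCoprime (q.map f) (X - C (f a))) : q.eval a ≠ 0 := by
  intro h
  have h_coprime := hq.map (evalRingHom (f a))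
  simp [eval_map_apply, h, isCoprime_zero_left] at h_coprime

theorem Module.End.aeval_apply_of_apply_eq_smul {R M : Type*} [CommRing R] [AddCommGroup M]
    [Module R M] {f : Module.End R M} {x : M} {a : R} (hx : f x = a • x) (q : R[X]) :
    aeval f q x = q.eval a • x := by
  by_cases h : x = 0
  · simp [h]
  · exact aeval_apply_of_hasEigenvector ⟨mem_eigenspace_iff.mpr hx, h⟩

open scoped commutatorElement in
/-- If `N ⋊[φ] G` is nilpotent and some `g : G` acts on `N` without nontrivial fixed points,
then `N` is trivial: `n ↦ n * (φ g n)⁻¹` preserves nontriviality and descends the lower central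
series. -/
theorem SemidirectProduct.subsingleton_of_isNilpotent {N G : Type*} [Group N] [Group G]
    (φ : G →* MulAut N) (hN : Group.IsNilpotent (N ⋊[φ] G)) (g : G)
    (hg : ∀ n, φ g n = n → n = 1) : Subsingleton N := by
  refine subsingleton_of_forall_eq 1 fun n => ?_
  by_contra hn
  have descend : ∀ k, ∃ m : N, m ≠ 1 ∧
      (inl m : N ⋊[φ] G) ∈ Subgroup.lowerCentralSeries (⊤ : Subgroup (N ⋊[φ] G)) k := by
    intro k
    induction k with
    | zero => exact ⟨n, hn, by simp⟩
    | succ k ih =>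
      obtain ⟨m, hm, hmem⟩ := ih
      refine ⟨m * (φ g m)⁻¹, fun h => hm (hg m (mul_inv_eq_one.mp h).symm), ?_⟩
      have h_comm : (inl (m * (φ g m)⁻¹) : N ⋊[φ] G) = ⁅(inl m : N ⋊[φ] G), inr g⁆ := by
        simp only [commutatorElement_def, map_mul, ← map_inv (φ g), inl_aut, map_inv inl,
          map_inv inr, mul_assoc]
      rw [h_comm]
      exact Subgroup.commutator_mem_commutator hmem (Subgroup.mem_top _)
  obtain ⟨k, hk⟩ := Subgroup.nilpotent_iff_lowerCentralSeries.mp hN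
  obtain ⟨m, hm, hmem⟩ := descend k
  rw [hk, Subgroup.mem_bot] at hmem
  exact hm (inl_injective (hmem.trans (map_one _).symm))

/-- Let `A ≅ ℤ_p^d` be an abelian group and `z` an automorphism of `A`.  If `q ∈ ℤ_p[t]` is
a polynomial coprime to `(t−1)` (in `ℚ_p[t]`), then `z` acts on `K = ker q(z) ⊆ A` with
finite fixed-point set `K^z`; in particular, if the semidirect product `K ⋊_z ℤ_p` is
nilpotent then `K` is finite. -/
theorem stmt13 (p : ℕ) [Fact p.Prime] (d : ℕ)
    (z : (Fin d → ℤ_[p]) ≃ₗ[ℤ_[p]] (Fin d → ℤ_[p]))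
    (q : Polynomial ℤ_[p])
    (hq : IsCoprime (q.map (algebraMap ℤ_[p] ℚ_[p])) (X - 1)) :
    ∀ K : Submodule ℤ_[p] (Fin d → ℤ_[p]),
      K = LinearMap.ker (Polynomial.aeval (z : Module.End ℤ_[p] (Fin d → ℤ_[p])) q) →
      -- the fixed-point set `K^z` is finite:
      {x : Fin d → ℤ_[p] | x ∈ K ∧ z x = x}.Finite ∧
      -- if the semidirect product `K ⋊_z ℤ_p` is nilpotent, then `K` is finite:
      (∀ (e : K ≃ₗ[ℤ_[p]] K), (∀ x : K, (e x : Fin d → ℤ_[p]) = z x) →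
        ∀ (φ : Multiplicative ℤ_[p] →* MulAut (Multiplicative K)),
          φ (Multiplicative.ofAdd (1 : ℤ_[p])) = AddEquiv.toMultiplicative e.toAddEquiv →
          Group.IsNilpotent ((Multiplicative K) ⋊[φ] (Multiplicative ℤ_[p])) →
          Finite K) := by
  rintro K rfl
  have h_eval : q.eval 1 ≠ 0 :=
    eval_ne_zero_of_isCoprime_map_X_sub_C (algebraMap ℤ_[p] ℚ_[p]) (by simpa using hq)
  have fixed_eq_zero : ∀ x ∈ LinearMap.ker (aeval (z : Module.End ℤ_[p] (Fin d → ℤ_[p])) q),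
      z x = x → x = 0 := by
    intro x hx hzx
    rw [LinearMap.mem_ker, Module.End.aeval_apply_of_apply_eq_smul (a := 1) (by simpa using hzx)]
      at hx
    exact (smul_eq_zero.mp hx).resolve_left h_eval
  refine ⟨(Set.finite_singleton 0).subset fun x hx => fixed_eq_zero x hx.1 hx.2, ?_⟩
  intro e he φ hφ hnil
  have h_sub := SemidirectProduct.subsingleton_of_isNilpotent φ hnil (Multiplicative.ofAdd 1) <| by
    intro x hx
    rw [hφ] at hx
    have h_fix : e x.toAdd = x.toAdd := congrArg Multiplicative.toAdd hx
    have h_zero := fixed_eq_zero _ x.toAdd.2 (by rw [← he, h_fix])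
    exact congrArg Multiplicative.ofAdd (Subtype.ext h_zero : x.toAdd = 0)
  exact @Finite.of_subsingleton _ (Multiplicative.ofAdd.subsingleton_congr.mpr h_sub)
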